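/- arXiv:1012.3854 — 3 statements merged into one kernel-verified Lean document; each statement's English description precedes it below -/
import Mathlib

section
/- For all $\delta>0$ and $\varepsilon>0$ there exists a smooth function $\rho:[0,\delta]\to[0,1]$ with the following properties: $\rho$ is nonincreasing, $\rho$ is constant equal to $1$ on a neighbourhood of $0$, $\rho$ is constant equal to $0$ on a neighbourhood of $\delta$, and $|x\,\rho'(x)|<\varepsilon$ for all $x\in[0,\delta]$. -/
open Set

lemma aux_bound : ∃ M : ℝ, 0 < M ∧ ∀ y, |deriv Real.smoothTransition y| < M := by
  have hc : Continuous (deriv Real.smoothTransition) :=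
    (Real.smoothTransition.contDiff (n := 1)).continuous_deriv (by norm_num)
  obtain ⟨C, hC⟩ := (isCompact_Icc (a := (0:ℝ)) (b := 1)).exists_bound_of_continuousOn
    hc.continuousOn
  have hC0 : 0 ≤ C := (norm_nonneg _).trans (hC 0 (by simp))
  refine ⟨C + 1, by linarith, fun y => ?_⟩
  rcases lt_or_ge y 0 with h | h
  · have : Real.smoothTransition =ᶠ[nhds y] fun _ => 0 := by
      filter_upwards [Iio_mem_nhds h] with z hz
      exact Real.smoothTransition.zero_of_nonpos (le_of_lt hz)
    rw [this.deriv_eq]; simp; linarith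
  rcases lt_or_ge 1 y with h1 | h1
  · have : Real.smoothTransition =ᶠ[nhds y] fun _ => 1 := by
      filter_upwards [Ioi_mem_nhds h1] with z hz
      exact Real.smoothTransition.one_of_one_le (le_of_lt hz)
    rw [this.deriv_eq]; simp; linarith
  have := hC y ⟨h, h1⟩
  rw [Real.norm_eq_abs] at this
  linarith

/-- **Cutoff lemma.** For all `δ > 0` and `ε > 0` there exists a smooth function
`ρ : [0,δ] → [0,1]` which is nonincreasing, constant `1` near `0`, constant `0`
near `δ`, and satisfies `|x ρ'(x)| < ε` for all `x ∈ [0,δ]`. -/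
theorem stmt_7 (δ ε : ℝ) (hδ : 0 < δ) (hε : 0 < ε) :
    ∃ ρ : ℝ → ℝ, ContDiff ℝ (⊤ : ℕ∞) ρ ∧
      (∀ x ∈ Icc (0:ℝ) δ, ρ x ∈ Icc (0:ℝ) 1) ∧
      AntitoneOn ρ (Icc 0 δ) ∧
      (∃ a > 0, ∀ x ∈ Icc (0:ℝ) δ, x ≤ a → ρ x = 1) ∧
      (∃ b < δ, 0 < b ∧ ∀ x ∈ Icc (0:ℝ) δ, b ≤ x → ρ x = 0) ∧
      (∀ x ∈ Icc (0:ℝ) δ, |x * deriv ρ x| < ε) := by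
  obtain ⟨M, hM, hb⟩ := aux_bound
  obtain ⟨c, hc, hcM⟩ : ∃ c : ℝ, 0 < c ∧ c * M = ε := ⟨ε / M, by positivity, by field_simp⟩
  set L := Real.log (δ / 2) with hL
  let ρ : ℝ → ℝ := fun x => if x ≤ 0 then 1 else Real.smoothTransition (c * (L - Real.log x))
  have hpos : ∀ x, 0 < x → ρ x = Real.smoothTransition (c * (L - Real.log x)) :=
    fun x hx => if_neg (not_le.2 hx)
  have hone : ∀ x, x ≤ Real.exp (L - 1 / c) → ρ x = 1 := by
    intro x hx
    rcases le_or_gt x 0 with h | h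
    · exact if_pos h
    rw [hpos x h]
    apply Real.smoothTransition.one_of_one_le
    have := (Real.log_le_iff_le_exp h).2 hx
    calc (1:ℝ) = c * (1 / c) := by field_simp
      _ ≤ _ := by gcongr; linarith
  have hev : ∀ x, 0 < x →
      ρ =ᶠ[nhds x] fun x => Real.smoothTransition (c * (L - Real.log x)) := by
    intro x hx
    filter_upwards [Ioi_mem_nhds hx] with z hz using hpos z hz
  have hev1 : ∀ x, x ≤ 0 → ρ =ᶠ[nhds x] fun _ => 1 := by
    intro x hx
    filter_upwards [Iio_mem_nhds (lt_of_le_of_lt hx (Real.exp_pos (L - 1 / c)))] with z hz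
    exact hone z (le_of_lt hz)
  have h01 : ∀ x, ρ x ∈ Icc (0:ℝ) 1 := by
    intro x
    rcases le_or_gt x 0 with h | h
    · rw [show ρ x = 1 from if_pos h]; simp
    · rw [hpos x h]
      exact ⟨Real.smoothTransition.nonneg _, Real.smoothTransition.le_one _⟩
  refine ⟨ρ, ?_, fun x _ => h01 x, ?_, ⟨_, Real.exp_pos (L - 1 / c), fun x _ => hone x⟩,
    ⟨δ / 2, by linarith, by linarith, ?_⟩, ?_⟩
  · rw [contDiff_iff_contDiffAt]
    intro x
    rcases le_or_gt x 0 with h | h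
    · exact contDiffAt_const.congr_of_eventuallyEq (hev1 x h)
    · refine ContDiffAt.congr_of_eventuallyEq ?_ (hev x h)
      have h2 : ContDiffAt ℝ (⊤ : ℕ∞) (fun x => c * (L - Real.log x)) x :=
        contDiffAt_const.mul (contDiffAt_const.sub (Real.contDiffAt_log.2 h.ne'))
      exact (Real.smoothTransition.contDiffAt).comp x h2
  · intro x _ y _ hxy
    rcases le_or_gt x 0 with h | h
    · rw [show ρ x = 1 from if_pos h]; exact (h01 y).2
    · rw [hpos x h, hpos y (h.trans_le hxy)]
      apply Real.smoothTransition.monotone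
      have := Real.log_le_log h hxy
      gcongr
  · intro x _ hx
    have h : 0 < x := by linarith
    rw [hpos x h]
    apply Real.smoothTransition.zero_of_nonpos
    have := Real.log_le_log (by linarith) hx
    exact mul_nonpos_of_nonneg_of_nonpos hc.le (by linarith)
  · intro x _
    rcases le_or_gt x 0 with h | h
    · rw [(hev1 x h).deriv_eq]; simpa using hε
    · rw [(hev x h).deriv_eq]
      have h2 : HasDerivAt (fun x => c * (L - Real.log x)) (c * (-x⁻¹)) x :=
        ((Real.hasDerivAt_log h.ne').const_sub L).const_mul c
      have h3 : HasDerivAt Real.smoothTransition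
          (deriv Real.smoothTransition (c * (L - Real.log x))) (c * (L - Real.log x)) :=
        ((Real.smoothTransition.contDiff (n := 1)).differentiable (by norm_num) _).hasDerivAt
      have h4 := (h3.comp x h2).deriv
      rw [show (fun x => Real.smoothTransition (c * (L - Real.log x))) =
        Real.smoothTransition ∘ (fun x => c * (L - Real.log x)) from rfl, h4]
      have h5 : x * (deriv Real.smoothTransition (c * (L - Real.log x)) * (c * -x⁻¹)) =
          -(c * deriv Real.smoothTransition (c * (L - Real.log x))) := by
        field_simp
      rw [h5, abs_neg, abs_mul, abs_of_pos hc, ← hcM]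
      exact mul_lt_mul_of_pos_left (hb _) hc
end

section
/- Let $\delta>0$ and let $h=(h_1,h_2):[-\delta,\delta]\to\mathbb{R}^2$ be a smooth immersion satisfying the contact condition $h_1'(r)h_2(r)-h_2'(r)h_1(r)>0$ and $h_1'(r)>0$ for all $r\in[-\delta,\delta]$, and assume in addition $h_2(0)>0$. Then for every $\varepsilon>0$ there exist a constant $A\in\mathbb{R}$ and $\delta'\in(0,\delta]$ such that: (a) for all $t\in[0,1]$ and all $r\in[-\delta',\delta']$ one has $h_1'(r)h_2(r)-h_2'(r)\,(h_1(r)+tA)>0$ (i.e. the immersion $h+t(A,0)$ satisfies the contact condition near $r=0$); and (b) $h_1(0)+A\in(0,\varepsilon)$. -/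
open Set

/-- **Lemma (adjustment, part (b)).** Let `h = (h₁,h₂) : [-δ,δ] → ℝ²` be a smooth
immersion satisfying the contact condition `h₁' h₂ - h₂' h₁ > 0` and `h₁' > 0`,
and assume `h₂ 0 > 0`. Then for every `ε > 0` there exist a constant `A ∈ ℝ` and
`δ' ∈ (0,δ]` such that for all `t ∈ [0,1]` the immersion `h + t(A,0)` satisfies
the contact condition on `[-δ',δ']`, and `h₁ 0 + A ∈ (0,ε)`. -/
theorem stmt_9 (δ : ℝ) (hδ : 0 < δ) (h₁ h₂ : ℝ → ℝ)
    (hsm₁ : ContDiff ℝ (⊤ : ℕ∞) h₁) (hsm₂ : ContDiff ℝ (⊤ : ℕ∞) h₂)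
    (himm : ∀ r ∈ Icc (-δ) δ, (deriv h₁ r, deriv h₂ r) ≠ (0, 0))
    (hcontact : ∀ r ∈ Icc (-δ) δ, 0 < deriv h₁ r * h₂ r - deriv h₂ r * h₁ r)
    (hmono : ∀ r ∈ Icc (-δ) δ, 0 < deriv h₁ r)
    (hh₂ : 0 < h₂ 0)
    (ε : ℝ) (hε : 0 < ε) :
    ∃ A : ℝ, ∃ δ' ∈ Ioc (0:ℝ) δ,
      (∀ t ∈ Icc (0:ℝ) 1, ∀ r ∈ Icc (-δ') δ',
        0 < deriv h₁ r * h₂ r - deriv h₂ r * (h₁ r + t * A)) ∧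
      h₁ 0 + A ∈ Ioo (0:ℝ) ε := by
  have c1 : Continuous (deriv h₁) := hsm₁.continuous_deriv (by simp)
  have c2 : Continuous (deriv h₂) := hsm₂.continuous_deriv (by simp)
  have k1 := hsm₁.continuous
  have k2 := hsm₂.continuous
  have h0 : (0:ℝ) ∈ Icc (-δ) δ := ⟨by linarith, hδ.le⟩
  have hc : 0 < deriv h₁ 0 * h₂ 0 := mul_pos (hmono 0 h0) hh₂
  obtain ⟨η, hη0, hηε, hη⟩ : ∃ η : ℝ, 0 < η ∧ η < ε ∧
      0 < deriv h₁ 0 * h₂ 0 - deriv h₂ 0 * η := by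
    have hcont : Continuous fun η : ℝ => deriv h₁ 0 * h₂ 0 - deriv h₂ 0 * η := by fun_prop
    have e1 : ∀ᶠ η in nhds (0:ℝ), 0 < deriv h₁ 0 * h₂ 0 - deriv h₂ 0 * η :=
      hcont.continuousAt.eventually (lt_mem_nhds (by simpa using hc))
    obtain ⟨ρ, hρ, H⟩ := Metric.eventually_nhds_iff.1 e1
    have hm : 0 < min ρ ε := lt_min hρ hε
    refine ⟨min ρ ε / 2, by linarith, by linarith [min_le_right ρ ε], H ?_⟩
    rw [Real.dist_eq, sub_zero, abs_of_pos (by linarith)]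
    linarith [min_le_left ρ ε]
  have hcont : Continuous fun r : ℝ =>
      deriv h₁ r * h₂ r - deriv h₂ r * (h₁ r + (η - h₁ 0)) := by fun_prop
  have e2 : ∀ᶠ r in nhds (0:ℝ),
      0 < deriv h₁ r * h₂ r - deriv h₂ r * (h₁ r + (η - h₁ 0)) :=
    hcont.continuousAt.eventually (lt_mem_nhds (by simpa using hη))
  obtain ⟨ρ, hρ, H⟩ := Metric.eventually_nhds_iff.1 e2
  have hm : 0 < min ρ δ := lt_min hρ hδ
  have hl := min_le_left ρ δ
  have hr := min_le_right ρ δ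
  refine ⟨η - h₁ 0, min ρ δ / 2, ⟨by linarith, by linarith⟩, ?_, by
    constructor <;> linarith⟩
  rintro t ⟨ht0, ht1⟩ r ⟨hr1, hr2⟩
  have F0 := hcontact r ⟨by linarith, by linarith⟩
  have F1 := H (y := r) (by
    rw [Real.dist_eq, sub_zero, abs_lt]; constructor <;> linarith)
  have key : deriv h₁ r * h₂ r - deriv h₂ r * (h₁ r + t * (η - h₁ 0)) =
      (1 - t) * (deriv h₁ r * h₂ r - deriv h₂ r * h₁ r) +
      t * (deriv h₁ r * h₂ r - deriv h₂ r * (h₁ r + (η - h₁ 0))) := by ring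
  rw [key]
  rcases ht0.eq_or_lt with rfl | ht
  · simpa using F0
  · exact add_pos_of_nonneg_of_pos (mul_nonneg (by linarith) F0.le) (mul_pos ht F1)
end

section
/- Let $V=S^1\times D^2_\delta$ be the solid torus with coordinate $\theta\in\mathbb{R}/2\pi\mathbb{Z}$ and polar coordinates $(r,\phi)$ on the disk of radius $\delta$, and let $\alpha_{st}=d\theta+r^2d\phi$. Let $n\in\mathbb{N}$ and let $\Theta:S^1\to S^1$ be an orientation-preserving diffeomorphism (viewed as a function of $\theta$ only) such that $d\Theta\wedge d\alpha_{st}>0$ on $V$. Write $n\Theta=n\theta+f$ for a smooth function $f:S^1\to\mathbb{R}$, and let $\rho:[0,\delta]\to[0,1]$ be any smooth nondecreasing function which vanishes near $0$ and is constant equal to $1$ near $\delta$. Then the map $\pi':=n\theta+\rho(r)f:V\to S^1$ satisfies $d\pi'\wedge d\alpha_{st}>0$ on $V$; in particular $\pi'$ is a submersion which agrees with $n\Theta$ near $\partial V$ and with $n\theta$ near the core circle $\{r=0\}$. -/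
open Set Real

/-- A point of the solid torus `S¹ × D²`, in coordinates `(θ, x, y)`: the first
coordinate is the angle along `S¹` (functions on the solid torus are required to be
periodic in it), and `(x,y)` are Cartesian coordinates on the disk, with associated
polar coordinates `(r,φ)`. -/
abbrev Pt : Type := ℝ × ℝ × ℝ

/-- Partial derivative in the angular (first) coordinate. -/
noncomputable def pdA (f : Pt → ℝ) (q : Pt) : ℝ := fderiv ℝ f q (1, 0, 0)
/-- Partial derivative in `x`. -/
noncomputable def pdX (f : Pt → ℝ) (q : Pt) : ℝ := fderiv ℝ f q (0, 1, 0)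
/-- Partial derivative in `y`. -/
noncomputable def pdY (f : Pt → ℝ) (q : Pt) : ℝ := fderiv ℝ f q (0, 0, 1)

/-- The coefficient, with respect to the orientation form `dθ∧dx∧dy`, of the 3-form
`c ∧ db`, where the 1-forms `c` and `b` are described by their coefficient functions
with respect to `(dθ, dx, dy)`. -/
noncomputable def wedgeD (c b : Pt → Pt) (q : Pt) : ℝ :=
  (c q).1 * (pdX (fun p => (b p).2.2) q - pdY (fun p => (b p).2.1) q)
  - (c q).2.1 * (pdA (fun p => (b p).2.2) q - pdY (fun p => (b p).1) q)
  + (c q).2.2 * (pdA (fun p => (b p).2.1) q - pdX (fun p => (b p).1) q)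

/-- The differential of a function, as a 1-form (coefficients w.r.t. `(dθ,dx,dy)`). -/
noncomputable def gradOf (f : Pt → ℝ) (q : Pt) : Pt := (pdA f q, pdX f q, pdY f q)

/-- The radial coordinate on the disk factor. -/
noncomputable def rad (q : Pt) : ℝ := Real.sqrt (q.2.1 ^ 2 + q.2.2 ^ 2)

/-- The solid torus of disk-radius `δ` (the angular coordinate ranges over all of `ℝ`;
periodicity is imposed on the functions involved). -/
def Vset (δ : ℝ) : Set Pt := {q | q.2.1 ^ 2 + q.2.2 ^ 2 ≤ δ ^ 2}

/-- Periodicity in the angular coordinate, for functions. -/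
def IsPeriodic (P : ℝ) (f : Pt → ℝ) : Prop := ∀ q : Pt, f (q.1 + P, q.2) = f q

/-- Periodicity in the angular coordinate, for (coefficient functions of) 1-forms. -/
def IsPeriodicForm (P : ℝ) (α : Pt → Pt) : Prop := ∀ q : Pt, α (q.1 + P, q.2) = α q

/-- The standard contact form `α_st = dθ + r²dφ = dθ + x dy - y dx` on the solid
torus, given by its coefficients `(1, -y, x)` w.r.t. `(dθ, dx, dy)`. -/
def alphaSt : Pt → Pt := fun q => (1, -q.2.2, q.2.1)


theorem wedgeD_alphaSt (c : Pt → Pt) (q : Pt) : wedgeD c alphaSt q = 2 * (c q).1 := by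
  have h1 : HasFDerivAt (fun p : Pt => p.2.1)
      ((ContinuousLinearMap.fst ℝ ℝ ℝ).comp (ContinuousLinearMap.snd ℝ ℝ (ℝ × ℝ))) q :=
    ((ContinuousLinearMap.fst ℝ ℝ ℝ).comp
      (ContinuousLinearMap.snd ℝ ℝ (ℝ × ℝ))).hasFDerivAt
  have h2 : HasFDerivAt (fun p : Pt => -p.2.2)
      (-((ContinuousLinearMap.snd ℝ ℝ ℝ).comp (ContinuousLinearMap.snd ℝ ℝ (ℝ × ℝ)))) q :=
    (((ContinuousLinearMap.snd ℝ ℝ ℝ).comp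
      (ContinuousLinearMap.snd ℝ ℝ (ℝ × ℝ))).hasFDerivAt).neg
  simp only [wedgeD, alphaSt, pdA, pdX, pdY, h1.fderiv, h2.fderiv]
  simp
  ring

theorem pdA_main (n : ℕ) (T ρ : ℝ → ℝ) (hT : Differentiable ℝ T) (q : Pt)
    (hd : DifferentiableAt ℝ (fun x : Pt => ρ (rad x)) q) :
    pdA (fun x => n * x.1 + ρ (rad x) * (n * T x.1 - n * x.1)) q
      = n + ρ (rad q) * (n * deriv T q.1 - n) := by
  have hF : DifferentiableAt ℝ
      (fun x : Pt => n * x.1 + ρ (rad x) * (n * T x.1 - n * x.1)) q := by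
    have : DifferentiableAt ℝ (fun x : Pt => T x.1) q :=
      (hT q.1).comp q differentiableAt_fst
    have h3 : DifferentiableAt ℝ (fun x : Pt => (n : ℝ) * x.1) q :=
      differentiableAt_fst.const_mul _
    exact h3.add (hd.mul ((this.const_mul (n : ℝ)).sub h3))
  have hl : HasDerivAt (fun t : ℝ => ((t, q.2) : Pt)) ((1, 0, 0) : Pt) q.1 :=
    (hasDerivAt_id q.1).prodMk (hasDerivAt_const q.1 q.2)
  have h1 := HasFDerivAt.comp_hasDerivAt q.1 (f := fun t : ℝ => ((t, q.2) : Pt))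
    hF.hasFDerivAt hl
  have h2 : HasDerivAt (fun t : ℝ => n * t + ρ (rad q) * (n * T t - n * t))
      (n * 1 + ρ (rad q) * (n * deriv T q.1 - n * 1)) q.1 :=
    ((hasDerivAt_id q.1).const_mul (n : ℝ)).add
      ((((hT q.1).hasDerivAt.const_mul (n : ℝ)).sub
        ((hasDerivAt_id q.1).const_mul (n : ℝ))).const_mul _)
  have := h1.unique h2
  simpa [pdA] using this

theorem diff_rho (δ : ℝ) (hδ : 0 < δ) (ρ : ℝ → ℝ) (hρ : Differentiable ℝ ρ)
    (hρ0 : ∃ a > 0, ∀ r ∈ Icc (0:ℝ) δ, r ≤ a → ρ r = 0) (q : Pt) :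
    DifferentiableAt ℝ (fun x : Pt => ρ (rad x)) q := by
  by_cases h : q.2.1 ^ 2 + q.2.2 ^ 2 = 0
  · obtain ⟨a, ha, H⟩ := hρ0
    have hc : Continuous rad := by unfold rad; fun_prop
    have h0 : rad q < min a δ := by
      have : rad q = 0 := by simp [rad, h]
      rw [this]; exact lt_min ha hδ
    have he : (fun x : Pt => ρ (rad x)) =ᶠ[nhds q] fun _ => (0 : ℝ) := by
      filter_upwards [hc.continuousAt.eventually (gt_mem_nhds h0)] with x hx
      exact H _ ⟨Real.sqrt_nonneg _, (hx.trans_le (min_le_right _ _)).le⟩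
        (hx.trans_le (min_le_left _ _)).le
    exact (differentiableAt_const _).congr_of_eventuallyEq he
  · have hr : DifferentiableAt ℝ rad q := by
      unfold rad
      exact DifferentiableAt.sqrt (by fun_prop) h
    exact (hρ _).comp q hr

/-- **Straightening the fibration near the core (Step 4 of the standardization).**
On `V = S¹ × D²_δ` (angle `θ` of period `2π`) with the standard contact form
`α_st = dθ + r²dφ`, let `n ∈ ℕ` and let `Θ` be an orientation-preserving
diffeomorphism of `S¹` (a function of `θ` only, encoded by a lift `T : ℝ → ℝ` with
`T(θ+2π) = T(θ)+2π` and `T' > 0`) such that `dΘ∧dα_st > 0` on `V`. Writing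
`nΘ = nθ + f` with `f` smooth and `2π`-periodic, for any smooth nondecreasing
`ρ : [0,δ] → [0,1]` vanishing near `0` and constant `1` near `δ`, the map
`π' := nθ + ρ(r)f` satisfies `dπ'∧dα_st > 0` on `V`; in particular `π'` is a
submersion agreeing with `nΘ` near `∂V` and with `nθ` near the core circle. -/
theorem stmt_12 (δ : ℝ) (hδ : 0 < δ) (n : ℕ) (hn : 0 < n)
    (T : ℝ → ℝ) (hTsm : ContDiff ℝ (⊤ : ℕ∞) T)
    (hTequiv : ∀ θ : ℝ, T (θ + 2 * π) = T θ + 2 * π)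
    (hT' : ∀ θ : ℝ, 0 < deriv T θ)
    (hTwedge : ∀ q ∈ Vset δ, 0 < wedgeD (fun x => (deriv T x.1, 0, 0)) alphaSt q)
    (ρ : ℝ → ℝ) (hρsm : ContDiff ℝ (⊤ : ℕ∞) ρ)
    (hρmono : MonotoneOn ρ (Icc 0 δ))
    (hρrange : ∀ r ∈ Icc (0:ℝ) δ, ρ r ∈ Icc (0:ℝ) 1)
    (hρ0 : ∃ a > 0, ∀ r ∈ Icc (0:ℝ) δ, r ≤ a → ρ r = 0)
    (hρ1 : ∃ b ∈ Ioo 0 δ, ∀ r ∈ Icc (0:ℝ) δ, b ≤ r → ρ r = 1) :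
    (∀ q ∈ Vset δ,
      0 < wedgeD (gradOf (fun x => n * x.1 + ρ (rad x) * (n * T x.1 - n * x.1)))
            alphaSt q) ∧
    (∀ q ∈ Vset δ,
      gradOf (fun x => n * x.1 + ρ (rad x) * (n * T x.1 - n * x.1)) q ≠ 0) ∧
    (∃ δ₁ ∈ Ioo 0 δ, ∀ q ∈ Vset δ, δ₁ ≤ rad q →
      n * q.1 + ρ (rad q) * (n * T q.1 - n * q.1) = n * T q.1) ∧
    (∃ η > 0, ∀ q ∈ Vset δ, rad q ≤ η →
      n * q.1 + ρ (rad q) * (n * T q.1 - n * q.1) = n * q.1) := by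
  have hTd : Differentiable ℝ T := hTsm.differentiable (by simp)
  have hρd : Differentiable ℝ ρ := hρsm.differentiable (by simp)
  have hrad : ∀ q ∈ Vset δ, rad q ∈ Icc (0:ℝ) δ := fun q hq =>
    ⟨Real.sqrt_nonneg _, Real.sqrt_le_iff.2 ⟨hδ.le, hq⟩⟩
  have key : ∀ q ∈ Vset δ,
      0 < pdA (fun x => n * x.1 + ρ (rad x) * (n * T x.1 - n * x.1)) q := by
    intro q hq
    rw [pdA_main n T ρ hTd q (diff_rho δ hδ ρ hρd hρ0 q)]
    obtain ⟨h0, h1⟩ := hρrange _ (hrad q hq)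
    have hn' : (0:ℝ) < n := by exact_mod_cast hn
    have hpos : 0 < (1 - ρ (rad q)) + ρ (rad q) * deriv T q.1 := by
      rcases h0.eq_or_lt with h | h
      · rw [← h]; norm_num
      · have := mul_pos h (hT' q.1)
        linarith
    have := mul_pos hn' hpos
    linarith
  refine ⟨fun q hq => ?_, fun q hq h => ?_, ?_, ?_⟩
  · rw [wedgeD_alphaSt]
    exact mul_pos two_pos (key q hq)
  · exact (key q hq).ne' (congrArg Prod.fst h)
  · obtain ⟨b, hb, H⟩ := hρ1
    refine ⟨b, hb, fun q hq h => ?_⟩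
    rw [H _ (hrad q hq) h]; ring
  · obtain ⟨a, ha, H⟩ := hρ0
    refine ⟨a, ha, fun q hq h => ?_⟩
    rw [H _ (hrad q hq) h]; ring
end
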